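/- arXiv:2310.12697 — 9 statements merged into one kernel-verified Lean document; each statement's English description precedes it below -/
import Mathlib

section
/- For every integer j ≥ 1 and every integer k with 0 ≤ k < j - 1, the k-th derivative of G_j at 0 equals 0. -/
/-- `G_j(v) = v^j/(1 - e^{-v})` for `v ≠ 0`, `G_1(0) = 1`, and `G_j(0) = 0` for `j > 1`. -/
noncomputable def G (j : ℕ) : ℝ → ℝ := fun v =>
  if v = 0 then (if j = 1 then 1 else 0) else v ^ j / (1 - Real.exp (-v))

lemma deriv_one_sub_exp_neg_zero : deriv (fun w : ℝ => 1 - Real.exp (-w)) 0 = 1 := by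
  have := ((hasDerivAt_neg (0 : ℝ)).exp.const_sub 1).deriv
  simpa using this

/-- `G_j` factors as `v ^ (j - 1)` times the inverse of the divided difference of
`1 - e^{-v}` at `0`. -/
lemma G_eq_pow_mul_inv_dslope (j : ℕ) (hj : 1 ≤ j) :
    G j = fun v => v ^ (j - 1) * (dslope (fun w : ℝ => 1 - Real.exp (-w)) 0 v)⁻¹ := by
  obtain ⟨n, rfl⟩ := Nat.exists_eq_add_of_le' hj
  funext v
  by_cases hv : v = 0
  · subst hv
    rcases n with _ | n <;> simp [G, deriv_one_sub_exp_neg_zero]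
  · simp only [G, hv, if_false, dslope_of_ne _ hv, slope_def_field, Nat.add_sub_cancel]
    simp only [neg_zero, Real.exp_zero, sub_self, sub_zero, inv_div]
    rw [pow_succ, mul_div_assoc]

/-- The divided difference of `1 - e^{-v}` at `0` has an analytic inverse at `0`. -/
lemma analyticAt_inv_dslope_one_sub_exp_neg :
    AnalyticAt ℝ (fun v => (dslope (fun w : ℝ => 1 - Real.exp (-w)) 0 v)⁻¹) 0 := by
  have hf : AnalyticAt ℝ (fun w : ℝ => 1 - Real.exp (-w)) 0 := by fun_prop
  obtain ⟨p, hp⟩ := hf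
  exact AnalyticAt.fun_inv ⟨_, hp.has_fpower_series_dslope_fslope⟩ (by simp [deriv_one_sub_exp_neg_zero])

/-- For `j ≥ 1` and `0 ≤ k < j - 1`, the `k`-th derivative of `G_j` at `0` vanishes. -/
theorem iteratedDeriv_G_zero_of_lt (j k : ℕ) (hj : 1 ≤ j) (hk : k < j - 1) :
    iteratedDeriv k (G j) 0 = 0 := by
  rw [G_eq_pow_mul_inv_dslope j hj, iteratedDeriv_fun_mul (by fun_prop)
    analyticAt_inv_dslope_one_sub_exp_neg.contDiffAt]
  refine Finset.sum_eq_zero fun i hi => ?_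
  have hij : i ≠ j - 1 := by
    have := Finset.mem_range.mp hi
    omega
  rw [iteratedDeriv_fun_pow_zero, if_neg hij, Nat.cast_zero, mul_zero, zero_mul]
end

section
/- For every integer j ≥ 1 and every integer k ≥ j - 1, the k-th derivative of G_j at 0 equals (-1)^{k-j+1} · k! · (k-j+2)! · Σ_{q=0}^{k-j+1} [(-1)^q/(q+1)] · S(k-j+q+1, q) / [(k-j-q+1)! · (k-j+q+1)!]. -/
/-- The Stirling numbers of the second kind `S(n,k)`. -/
def S : ℕ → ℕ → ℕ
  | 0, 0 => 1
  | 0, _ + 1 => 0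
  | _ + 1, 0 => 0
  | n + 1, k + 1 => (k + 1) * S n (k + 1) + S n k

open PowerSeries in
/-- The exponential generating function of the Stirling numbers of the second kind. -/
theorem coeff_exp_sub_one_pow (n q : ℕ) :
    coeff n ((exp ℝ - 1) ^ q) = (q.factorial : ℝ) * S n q / n.factorial := by
  induction n generalizing q with
  | zero =>
    cases q with
    | zero => simp [S]
    | succ q => simp [S]
  | succ n ih =>
    cases q with
    | zero => simp [S, coeff_one]
    | succ q =>
      have hderiv : derivative ℝ ((exp ℝ - 1) ^ (q + 1)) =
          C ((q : ℝ) + 1) * ((exp ℝ - 1) ^ (q + 1) + (exp ℝ - 1) ^ q) := by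
        have hexp : derivative ℝ (exp ℝ - 1) = exp ℝ := by
          rw [map_sub, derivative_one, sub_zero]
          ext i
          simp only [coeff_derivative, coeff_exp, Nat.factorial_succ]
          have := Nat.factorial_ne_zero i
          push_cast
          field_simp
        rw [derivative_pow, hexp]
        simp only [Nat.add_sub_cancel, Nat.cast_add, Nat.cast_one, map_add, map_natCast, map_one]
        ring
      have hcoeff := congrArg (coeff n) hderiv
      rw [coeff_derivative, coeff_C_mul, map_add, ih, ih] at hcoeff
      have hn : ((n : ℝ) + 1) ≠ 0 := by positivity
      rw [eq_div_iff (by positivity)]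
      simp only [S, Nat.factorial_succ] at hcoeff ⊢
      push_cast at hcoeff ⊢
      rw [← mul_assoc, hcoeff]
      field_simp

/-- The power series of `(e ^ x - 1) / x`. -/
noncomputable def expSlopeSeries : PowerSeries ℝ :=
  PowerSeries.mk fun n => ((n + 1).factorial : ℝ)⁻¹

open PowerSeries in
theorem X_mul_expSlopeSeries : X * expSlopeSeries = exp ℝ - 1 := by
  ext n
  cases n with
  | zero => simp
  | succ n => simp [expSlopeSeries, coeff_succ_X_mul, coeff_exp, coeff_one]

open PowerSeries in
theorem coeff_expSlopeSeries_pow (m q : ℕ) :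
    coeff m (expSlopeSeries ^ q) = (q.factorial : ℝ) * S (m + q) q / (m + q).factorial := by
  rw [← coeff_exp_sub_one_pow, ← X_mul_expSlopeSeries, mul_pow, coeff_X_pow_mul]

/-- Since `1 - f` has no constant term, the inverse of `f` agrees up to order `m` with
`(1 - (1 - f) ^ (m + 1)) / f`. -/
theorem PowerSeries.coeff_eq_sum_of_mul_eq_one {R : Type*} [CommRing R] {f g : PowerSeries R}
    (hgf : g * f = 1) (hf : constantCoeff f = 1) (m : ℕ) :
    coeff m g =
      ∑ q ∈ Finset.range (m + 1), (-1) ^ q * ((m + 1).choose (q + 1) : R) * coeff m (f ^ q) := by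
  have hbinom : (1 - f) ^ (m + 1) = 1 - f * ∑ q ∈ Finset.range (m + 1),
      C ((-1) ^ q * ((m + 1).choose (q + 1) : R)) * f ^ q := by
    rw [sub_eq_neg_add, add_pow, Finset.sum_range_succ', Finset.mul_sum, ← sub_eq_zero]
    simp only [one_pow, mul_one, pow_zero, Nat.choose_zero_right, Nat.cast_one]
    rw [sub_sub_eq_add_sub, add_right_comm, add_sub_cancel_right, ← Finset.sum_add_distrib]
    refine Finset.sum_eq_zero fun q _ => ?_
    simp only [map_mul, map_pow, map_neg, map_one, map_natCast, neg_pow f]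
    ring
  have hsum : ∑ q ∈ Finset.range (m + 1),
      C ((-1) ^ q * ((m + 1).choose (q + 1) : R)) * f ^ q = g - g * (1 - f) ^ (m + 1) := by
    rw [hbinom, mul_sub, ← mul_assoc, hgf]
    ring
  have hdvd : X ^ (m + 1) ∣ g * (1 - f) ^ (m + 1) :=
    (pow_dvd_pow_of_dvd (X_dvd_iff.2 (by simp [hf])) _).mul_left g
  have hcoeff := congrArg (coeff m) hsum
  rw [map_sub, X_pow_dvd_iff.1 hdvd m (Nat.lt_succ_self m), sub_zero] at hcoeff
  rw [← hcoeff, map_sum]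
  simp only [coeff_C_mul]

/-- The Taylor series at `0` of a real function, as a formal power series. -/
noncomputable def taylorSeriesZero (f : ℝ → ℝ) : PowerSeries ℝ :=
  PowerSeries.mk fun n => iteratedDeriv n f 0 / n.factorial

theorem taylorSeriesZero_mul {f g : ℝ → ℝ} (hf : AnalyticAt ℝ f 0) (hg : AnalyticAt ℝ g 0) :
    taylorSeriesZero (f * g) = taylorSeriesZero f * taylorSeriesZero g := by
  ext n
  simp only [taylorSeriesZero, PowerSeries.coeff_mul, PowerSeries.coeff_mk]
  rw [iteratedDeriv_mul hf.contDiffAt hg.contDiffAt, Finset.sum_div,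
    Finset.Nat.sum_antidiagonal_eq_sum_range_succ
      (fun a b => iteratedDeriv a f 0 / a.factorial * (iteratedDeriv b g 0 / b.factorial))]
  refine Finset.sum_congr rfl fun i hi => ?_
  rw [Nat.cast_choose ℝ (Finset.mem_range_succ_iff.1 hi)]
  field_simp

theorem taylorSeriesZero_pow (m : ℕ) :
    taylorSeriesZero (fun v => v ^ m) = PowerSeries.X ^ m := by
  ext n
  simp only [taylorSeriesZero, PowerSeries.coeff_mk, iteratedDeriv_fun_pow_zero,
    PowerSeries.coeff_X_pow]
  split_ifs with h
  · subst h
    field_simp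
  · simp

theorem taylorSeriesZero_one_sub_exp_neg :
    taylorSeriesZero (fun v => 1 - Real.exp (-v)) =
      PowerSeries.X * PowerSeries.evalNegHom expSlopeSeries := by
  have hX : PowerSeries.X * PowerSeries.evalNegHom expSlopeSeries =
      PowerSeries.evalNegHom (1 - PowerSeries.exp ℝ) := by
    rw [← neg_sub, ← X_mul_expSlopeSeries, map_neg, map_mul, PowerSeries.evalNegHom_X]
    ring
  rw [hX]
  ext n
  have hderiv : iteratedDeriv n (fun v => Real.exp (-v)) 0 = (-1) ^ n := by
    simpa using congrFun (iteratedDeriv_exp_const_mul n (-1)) 0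
  simp only [taylorSeriesZero, PowerSeries.coeff_mk, PowerSeries.evalNegHom,
    PowerSeries.coeff_rescale, map_sub, PowerSeries.coeff_one, PowerSeries.coeff_exp, map_one]
  rw [iteratedDeriv_fun_sub contDiffAt_const (by fun_prop), hderiv, iteratedDeriv_const]
  cases n with
  | zero => simp
  | succ n => simp [div_eq_mul_inv]

theorem one_sub_exp_neg_ne_zero {v : ℝ} (hv : v ≠ 0) : 1 - Real.exp (-v) ≠ 0 :=
  sub_ne_zero.2 fun h => hv (by simpa using h.symm)

theorem G_one_mul (v : ℝ) : G 1 v * (1 - Real.exp (-v)) = v := by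
  by_cases hv : v = 0
  · simp [hv]
  · simp [G, hv, div_mul_cancel₀ _ (one_sub_exp_neg_ne_zero hv)]

theorem G_succ (i : ℕ) : G (i + 1) = (fun v => v ^ i) * G 1 := by
  funext v
  by_cases hv : v = 0
  · cases i <;> simp [G, hv]
  · simp [G, hv, pow_succ, mul_div_assoc]

theorem analyticAt_G_one : AnalyticAt ℝ (G 1) 0 := by
  have hexp : AnalyticAt ℝ (fun v => 1 - Real.exp (-v)) 0 := by fun_prop
  have hderiv : deriv (fun v => 1 - Real.exp (-v)) 0 = 1 := by
    have h : HasDerivAt (fun v : ℝ => 1 - Real.exp (-v)) 1 0 := by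
      simpa using ((hasDerivAt_neg (0 : ℝ)).exp).const_sub 1
    exact h.deriv
  have hslope : AnalyticAt ℝ (dslope (fun v => 1 - Real.exp (-v)) 0) 0 := by
    obtain ⟨p, hp⟩ := hexp
    exact hp.has_fpower_series_dslope_fslope.analyticAt
  have hG : G 1 = (dslope (fun v => 1 - Real.exp (-v)) 0)⁻¹ := by
    funext v
    by_cases hv : v = 0
    · simp [hv, G, hderiv]
    · simp [G, hv, dslope_of_ne, slope_def_field]
  rw [hG]
  exact hslope.inv (by simp [hderiv])

theorem evalNegHom_taylorSeriesZero_G_one_mul :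
    PowerSeries.evalNegHom (taylorSeriesZero (G 1)) * expSlopeSeries = 1 := by
  have hprod : taylorSeriesZero (G 1) * (PowerSeries.X * PowerSeries.evalNegHom expSlopeSeries) =
      PowerSeries.X := by
    rw [← taylorSeriesZero_one_sub_exp_neg, ← taylorSeriesZero_mul analyticAt_G_one (by fun_prop)]
    have h : (G 1 * fun v => 1 - Real.exp (-v)) = fun v => v ^ 1 := by
      funext v
      simpa using G_one_mul v
    rw [h, taylorSeriesZero_pow, pow_one]
  have hone : taylorSeriesZero (G 1) * PowerSeries.evalNegHom expSlopeSeries = 1 := by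
    refine mul_left_cancel₀ (PowerSeries.X_ne_zero (R := ℝ)) ?_
    rw [mul_one, mul_left_comm, hprod]
  have h := congrArg PowerSeries.evalNegHom hone
  rw [map_mul, map_one] at h
  rwa [PowerSeries.evalNegHom, PowerSeries.rescale_rescale, neg_one_mul, neg_neg,
    PowerSeries.rescale_one] at h

theorem coeff_taylorSeriesZero_G_one (m : ℕ) :
    PowerSeries.coeff m (taylorSeriesZero (G 1)) =
      (-1) ^ m * (m + 1).factorial * ∑ q ∈ Finset.range (m + 1),
        ((-1 : ℝ) ^ q / (q + 1)) * (S (m + q) q) / ((m - q).factorial * (m + q).factorial) := by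
  have hneg : PowerSeries.coeff m (taylorSeriesZero (G 1)) =
      (-1) ^ m * PowerSeries.coeff m (PowerSeries.evalNegHom (taylorSeriesZero (G 1))) := by
    rw [PowerSeries.evalNegHom, PowerSeries.coeff_rescale, ← mul_assoc, ← mul_pow]
    simp
  rw [hneg, PowerSeries.coeff_eq_sum_of_mul_eq_one evalNegHom_taylorSeriesZero_G_one_mul
    (by simp [expSlopeSeries, ← PowerSeries.coeff_zero_eq_constantCoeff_apply]), mul_assoc]
  congr 1
  rw [Finset.mul_sum]
  refine Finset.sum_congr rfl fun q hq => ?_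
  rw [coeff_expSlopeSeries_pow,
    Nat.cast_choose ℝ (Nat.succ_le_succ (Finset.mem_range_succ_iff.1 hq)),
    Nat.succ_sub_succ, Nat.factorial_succ q]
  push_cast
  field_simp

/-- For `j ≥ 1` and `k ≥ j - 1`, a closed form for the `k`-th derivative of `G_j` at `0`
in terms of the Stirling numbers of the second kind.  (Here `k - j + 1` is written as
`k + 1 - j`, etc., so that all subtractions of natural numbers are exact.) -/
theorem iteratedDeriv_G_zero_of_ge (j k : ℕ) (hj : 1 ≤ j) (hk : j - 1 ≤ k) :
    iteratedDeriv k (G j) 0 =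
      (-1 : ℝ) ^ (k + 1 - j) * (Nat.factorial k) * (Nat.factorial (k + 2 - j)) *
        ∑ q ∈ Finset.range (k + 1 - j + 1),
          ((-1 : ℝ) ^ q / (q + 1)) * (S (k + 1 - j + q) q) /
            ((Nat.factorial (k + 1 - j - q)) * (Nat.factorial (k + 1 - j + q))) := by
  obtain ⟨i, rfl⟩ := Nat.exists_eq_add_of_le' hj
  obtain ⟨m, rfl⟩ := Nat.exists_eq_add_of_le' hk
  have hm : m + (i + 1 - 1) + 1 - (i + 1) = m := by omega
  have hm' : m + (i + 1 - 1) + 2 - (i + 1) = m + 1 := by omega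
  rw [hm, hm', Nat.add_sub_cancel]
  have hcoeff : iteratedDeriv (m + i) (G (i + 1)) 0 =
      (m + i).factorial * PowerSeries.coeff (m + i) (taylorSeriesZero (G (i + 1))) := by
    rw [taylorSeriesZero, PowerSeries.coeff_mk]
    field_simp
  rw [hcoeff, G_succ, taylorSeriesZero_mul (by fun_prop) analyticAt_G_one, taylorSeriesZero_pow,
    PowerSeries.coeff_X_pow_mul, coeff_taylorSeriesZero_G_one]
  ring
end

section
/- For every integer j ≥ 1, every integer k ≥ 0, and every real v, the k-th derivative of G_j at v equals (-1)^k / F₁(v)^{k+1} times the determinant of the (k+1)×(k+1) matrix W whose entries (indexed by 1 ≤ i, ℓ ≤ k+1) are: W_{i,1} equals the (i-1)-th derivative of the function t ↦ t^{j-1} evaluated at v, and for ℓ ≥ 2, W_{i,ℓ} = C(i-1, ℓ-2) · F₁^{(i-ℓ+1)}(v) if i ≥ ℓ - 1 and W_{i,ℓ} = 0 if i < ℓ - 1, where C(·,·) denotes the binomial coefficient and F₁^{(m)} is the m-th derivative of F₁. -/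
/-- `F₁(v) = (1 - e^{-v})/v` for `v ≠ 0`, and `F₁(0) = 1`. -/
noncomputable def F1 : ℝ → ℝ := fun v => if v = 0 then 1 else (1 - Real.exp (-v)) / v

open Matrix in
/-- A matrix whose columns are `g, e₀, …, e_{k-1}` has determinant `(-1)^k g_k`. -/
theorem det_cons_shifted_one {R : Type*} [CommRing R] (k : ℕ) (g : ℕ → R) :
    det (of fun i l : Fin (k + 1) =>
      if (l : ℕ) = 0 then g i else if (i : ℕ) + 1 = l then 1 else 0) = (-1) ^ k * g k := by
  rw [det_succ_row _ (Fin.last k), Finset.sum_eq_single 0]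
  · have hsub : (submatrix (of fun i l : Fin (k + 1) =>
        if (l : ℕ) = 0 then g i else if (i : ℕ) + 1 = l then (1 : R) else 0)
        (Fin.last k).succAbove (0 : Fin (k + 1)).succAbove) = 1 := by
      ext i l
      simp only [submatrix_apply, of_apply, Fin.succAbove_last, Fin.succAbove_zero, one_apply,
        Fin.val_succ, Fin.val_castSucc, Nat.add_right_cancel_iff, Nat.succ_ne_zero, if_false,
        Fin.ext_iff]
    rw [hsub]
    simp
  · intro l _ hl
    have hlk : ¬ k + 1 = (l : ℕ) := by have := l.isLt; omega
    simp [hl, hlk]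
  · simp

open Matrix in
/-- Solving the triangular Leibniz system for the last unknown by Cramer's rule. -/
theorem det_leibniz {R : Type*} [CommRing R] (k : ℕ) (f g b : ℕ → R)
    (h : ∀ i, b i = ∑ m ∈ Finset.range (i + 1), (i.choose m : R) * g m * f (i - m)) :
    det (of fun i l : Fin (k + 1) =>
      if (l : ℕ) = 0 then b i
      else if (l : ℕ) ≤ (i : ℕ) + 1 then ((i : ℕ).choose ((l : ℕ) - 1) : R) * f ((i : ℕ) + 1 - l)
      else 0) = f 0 ^ (k + 1) * ((-1) ^ k * g k) := by
  set L : Matrix (Fin (k + 1)) (Fin (k + 1)) R := of fun i m =>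
    if (m : ℕ) ≤ i then ((i : ℕ).choose m : R) * f (i - m) else 0 with hL
  have hLdet : L.det = f 0 ^ (k + 1) := by
    rw [det_of_isLowerTriangular L]
    · simp [hL]
    · intro i m him
      have him' : ¬ m ≤ i := not_le.2 him
      simp [hL, him']
  rw [← hLdet, ← det_cons_shifted_one k g, ← det_mul]
  congr 1
  ext i l
  rw [mul_apply]
  simp only [hL, of_apply]
  refine Fin.cases ?_ (fun p => ?_) l
  · simp only [Fin.val_zero, if_true]
    rw [h, Fin.sum_univ_eq_sum_range
      (fun m => (if m ≤ (i : ℕ) then ((i : ℕ).choose m : R) * f (i - m) else 0) * g m) (k + 1)]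
    refine Finset.sum_subset_zero_on_sdiff (Finset.range_mono (by omega)) ?_ ?_
    · intro m hm
      have : ¬ m ≤ (i : ℕ) := by
        simp only [Finset.mem_sdiff, Finset.mem_range] at hm
        omega
      simp [this]
    · intro m hm
      rw [if_pos (by simpa [Nat.lt_succ_iff] using hm)]
      ring
  · rw [Finset.sum_eq_single p.castSucc]
    · simp
    · intro m _ hm
      have : ¬ (m : ℕ) = p := fun h => hm (Fin.ext h)
      simp [this]
    · simp

theorem F1_eq_dslope : F1 = dslope (fun v : ℝ => 1 - Real.exp (-v)) 0 := by
  funext v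
  by_cases hv : v = 0
  · subst hv
    have h : HasDerivAt (fun v : ℝ => 1 - Real.exp (-v)) 1 0 := by
      simpa using ((hasDerivAt_neg (0 : ℝ)).exp).const_sub 1
    simp [F1, h.deriv]
  · rw [dslope_of_ne _ hv]
    simp [F1, hv, slope_def_field]

theorem contDiff_F1 {n : WithTop ℕ∞} : ContDiff ℝ n F1 := by
  have hnum : ∀ v : ℝ, AnalyticAt ℝ (fun v : ℝ => 1 - Real.exp (-v)) v := fun v => by fun_prop
  refine contDiff_iff_contDiffAt.2 fun v => AnalyticAt.contDiffAt ?_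
  by_cases hv : v = 0
  · subst hv
    obtain ⟨p, hp⟩ := hnum 0
    rw [F1_eq_dslope]
    exact hp.has_fpower_series_dslope_fslope.analyticAt
  · refine ((hnum v).div analyticAt_id hv).congr ?_
    filter_upwards [isOpen_ne.mem_nhds hv] with t ht
    exact (if_neg ht).symm

theorem F1_ne_zero (v : ℝ) : F1 v ≠ 0 := by
  by_cases hv : v = 0
  · simp [F1, hv]
  · simpa [F1, hv] using one_sub_exp_neg_ne_zero hv

theorem G_eq_div_F1 {j : ℕ} (hj : 1 ≤ j) : G j = fun v => v ^ (j - 1) / F1 v := by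
  obtain ⟨m, rfl⟩ := Nat.exists_eq_add_of_le' hj
  funext v
  by_cases hv : v = 0
  · by_cases hm : m = 0 <;> simp [G, F1, hv, hm]
  · have := one_sub_exp_neg_ne_zero hv
    simp only [G, F1, hv, if_false, Nat.add_sub_cancel]
    rw [pow_succ]
    field_simp

theorem contDiff_G {j : ℕ} (hj : 1 ≤ j) {n : WithTop ℕ∞} : ContDiff ℝ n (G j) := by
  rw [G_eq_div_F1 hj]
  exact (contDiff_id.pow _).div contDiff_F1 F1_ne_zero

theorem G_mul_F1 {j : ℕ} (hj : 1 ≤ j) : G j * F1 = fun v => v ^ (j - 1) := by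
  rw [G_eq_div_F1 hj]
  funext v
  exact div_mul_cancel₀ _ (F1_ne_zero v)

/-- Determinantal expression:
`G_j^{(k)}(v) = (-1)^k / F₁(v)^{k+1} · det W`, where the `(k+1)×(k+1)` matrix `W`
(indexed here from `0`) has first column `W_{i,0} = (t ↦ t^{j-1})^{(i)}(v)` and, for
`ℓ ≥ 1`, `W_{i,ℓ} = C(i, ℓ-1) F₁^{(i+1-ℓ)}(v)` when `ℓ ≤ i + 1` and `W_{i,ℓ} = 0`
otherwise. -/
theorem iteratedDeriv_G_det (j k : ℕ) (hj : 1 ≤ j) (v : ℝ) :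
    iteratedDeriv k (G j) v =
      (-1 : ℝ) ^ k / (F1 v) ^ (k + 1) *
        Matrix.det (fun i ℓ : Fin (k + 1) =>
          if (ℓ : ℕ) = 0 then
            iteratedDeriv (i : ℕ) (fun t : ℝ => t ^ (j - 1)) v
          else if (ℓ : ℕ) ≤ (i : ℕ) + 1 then
            (Nat.choose (i : ℕ) ((ℓ : ℕ) - 1)) * iteratedDeriv ((i : ℕ) + 1 - (ℓ : ℕ)) F1 v
          else 0) := by
  have hdet := det_leibniz k (fun m => iteratedDeriv m F1 v) (fun m => iteratedDeriv m (G j) v)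
    (fun m => iteratedDeriv m (fun t : ℝ => t ^ (j - 1)) v) ?_
  · refine Eq.trans ?_ (congrArg (_ * ·) hdet.symm)
    have hF := F1_ne_zero v
    have hs : ((-1 : ℝ) ^ k) * (-1) ^ k = 1 := by rw [← mul_pow]; simp
    rw [iteratedDeriv_zero]
    field_simp
    linear_combination (-iteratedDeriv k (G j) v) * hs
  · intro i
    rw [← G_mul_F1 hj, iteratedDeriv_mul (contDiff_G hj).contDiffAt contDiff_F1.contDiffAt]
end

section
/- For every integer j ≥ 0, the determinant of the (j+1)×(j+1) lower Hessenberg matrix A whose entries (indexed by 1 ≤ i, ℓ ≤ j+1) are A_{i,ℓ} = 1/(i-ℓ+2)! when ℓ ≤ i+1 and A_{i,ℓ} = 0 when ℓ > i+1 (so the diagonal entries are 1/2!, the entries on the first superdiagonal are 1, and the entries on the m-th subdiagonal are 1/(m+2)!) equals (-1)^{j+1} · B_{j+1}/(j+1)!. -/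
open Finset in
/-- If the sequence `b` is the convolution inverse of the sequence `a` with `a 0 = 1`, then the
determinant of the Hessenberg Toeplitz matrix with entries `a (i + 1 - ℓ)` is `(-1) ^ n * b n`. -/
theorem det_hessenberg_toeplitz {R : Type*} [CommRing R] (a b : ℕ → R) (ha : a 0 = 1)
    (hab : ∀ n, ∑ p ∈ antidiagonal n, b p.1 * a p.2 = if n = 0 then 1 else 0) (n : ℕ) :
    Matrix.det (fun i ℓ : Fin n => if (ℓ : ℕ) ≤ (i : ℕ) + 1 then a ((i : ℕ) + 1 - ℓ) else 0) =
      (-1) ^ n * b n := by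
  let T : Matrix (Fin (n + 1)) (Fin (n + 1)) R :=
    fun i ℓ => if (ℓ : ℕ) ≤ (i : ℕ) then a ((i : ℕ) - ℓ) else 0
  have hdet : T.det = 1 := by
    rw [Matrix.det_of_isLowerTriangular T fun i ℓ h => if_neg (not_le.mpr h)]
    simp [T, ha]
  have hTb : T.mulVec (fun ℓ => b ℓ) = Pi.single 0 1 := by
    ext i
    have hsum : T.mulVec (fun ℓ => b ℓ) i = ∑ k ∈ range ((i : ℕ) + 1), b k * a ((i : ℕ) - k) := by
      rw [Matrix.mulVec, dotProduct, Fin.sum_univ_eq_sum_range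
        (fun k => (if k ≤ (i : ℕ) then a ((i : ℕ) - k) else 0) * b k) (n + 1)]
      rw [← sum_subset (range_subset_range.mpr (Nat.succ_le_of_lt i.isLt))]
      · refine sum_congr rfl fun k hk => ?_
        rw [if_pos (Nat.lt_succ_iff.mp (mem_range.mp hk)), mul_comm]
      · intro k _ hk
        rw [if_neg (by simpa [Nat.lt_succ_iff] using hk), zero_mul]
    rw [hsum, ← Nat.sum_antidiagonal_eq_sum_range_succ (fun k m => b k * a m), hab]
    simp only [Pi.single_apply, Fin.ext_iff, Fin.val_zero]
  have hadj : T.adjugate (Fin.last n) 0 = b n := by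
    have h : T.adjugate.mulVec (T.mulVec fun ℓ => b ℓ) (Fin.last n) = b n := by
      simp [Matrix.mulVec_mulVec, Matrix.adjugate_mul, hdet]
    simpa [hTb] using h
  rw [Matrix.adjugate_fin_succ_eq_det_submatrix] at hadj
  have hsub : T.submatrix (Fin.succAbove 0) (Fin.succAbove (Fin.last n)) =
      fun i ℓ : Fin n => if (ℓ : ℕ) ≤ (i : ℕ) + 1 then a ((i : ℕ) + 1 - ℓ) else 0 := by
    ext i ℓ
    rw [Matrix.submatrix_apply, Fin.zero_succAbove, Fin.succAbove_last]
    simp only [T, Fin.val_succ, Fin.val_castSucc]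
  rw [hsub] at hadj
  rw [← hadj, ← mul_assoc]
  simp [← mul_pow]

open Finset in
/-- The sequences `B_k / k!` and `1 / (m + 1)!` are convolution inverses of each other. -/
theorem sum_antidiagonal_bernoulli_div_factorial (n : ℕ) :
    ∑ p ∈ antidiagonal n,
      ((bernoulli p.1 : ℚ) : ℝ) / p.1.factorial * (1 / ((p.2 + 1).factorial : ℝ)) =
      if n = 0 then 1 else 0 := by
  have hterm : ∀ p ∈ antidiagonal n,
      ((bernoulli p.1 : ℚ) : ℝ) / p.1.factorial * (1 / ((p.2 + 1).factorial : ℝ)) =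
      (((p.1 + p.2).choose p.2 / (p.2 + 1) * bernoulli p.1 : ℚ) : ℝ) / n.factorial := by
    intro p hp
    rw [← mem_antidiagonal.mp hp, Nat.add_comm p.1 p.2]
    have h : ((p.2 + p.1).choose p.2 : ℝ) * p.2.factorial * p.1.factorial =
        (p.2 + p.1).factorial := by
      rw [Nat.choose_symm_add]
      exact_mod_cast Nat.add_choose_mul_factorial_mul_factorial p.2 p.1
    have h₁ : (p.1.factorial : ℝ) ≠ 0 := by positivity
    have h₂ : (p.2.factorial : ℝ) ≠ 0 := by positivity
    have h₃ : ((p.2 + p.1).factorial : ℝ) ≠ 0 := by positivity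
    have h₄ : (p.2 : ℝ) + 1 ≠ 0 := by positivity
    push_cast [Nat.factorial_succ]
    field_simp
    rw [← h]
    ring
  rw [sum_congr rfl hterm, ← sum_div, ← Rat.cast_sum, bernoulli_spec' n]
  split_ifs with hn <;> simp [hn]

/-- For `j ≥ 0`, the `(j+1)×(j+1)` lower Hessenberg determinant with entries
`A_{i,ℓ} = 1/(i-ℓ+2)!` for `ℓ ≤ i+1` (indexing from `0`: superdiagonal entries `1`,
diagonal entries `1/2!`, `m`-th subdiagonal entries `1/(m+2)!`) equals
`(-1)^{j+1} B_{j+1}/(j+1)!`, where `B_n` are the Bernoulli numbers (`B₁ = -1/2`). -/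
theorem hessenberg_det_bernoulli (j : ℕ) :
    Matrix.det (fun i ℓ : Fin (j + 1) =>
        if (ℓ : ℕ) ≤ (i : ℕ) + 1 then
          (1 : ℝ) / (Nat.factorial ((i : ℕ) + 2 - (ℓ : ℕ)))
        else 0) =
      (-1 : ℝ) ^ (j + 1) * ((bernoulli (j + 1) : ℚ) : ℝ) / (Nat.factorial (j + 1)) := by
  have h := det_hessenberg_toeplitz (fun m => 1 / ((m + 1).factorial : ℝ))
    (fun k => ((bernoulli k : ℚ) : ℝ) / k.factorial) (by simp)
    sum_antidiagonal_bernoulli_div_factorial (j + 1)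
  rw [mul_div_assoc, ← h]
  congr 1
  ext i ℓ
  split_ifs with hle
  · rw [show (i : ℕ) + 2 - ℓ = (i : ℕ) + 1 - ℓ + 1 by omega]
  · rfl
end

section
/- For every integer j ≥ 1 and every integer k ≥ j − 1, the k-th derivative of G_j at 0 equals k! · (-1)^{k-j+1} · B_{k-j+1}/(k-j+1)!. -/
/-- The formal Taylor series at `0` of a real function. -/
noncomputable def taylorSeriesAtZero (f : ℝ → ℝ) : PowerSeries ℝ :=
  PowerSeries.mk fun n => iteratedDeriv n f 0 / (Nat.factorial n)

theorem taylorSeriesAtZero_mul {f g : ℝ → ℝ} (hf : ContDiffAt ℝ ⊤ f 0)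
    (hg : ContDiffAt ℝ ⊤ g 0) :
    taylorSeriesAtZero (f * g) = taylorSeriesAtZero f * taylorSeriesAtZero g := by
  ext n
  simp only [taylorSeriesAtZero, PowerSeries.coeff_mk, PowerSeries.coeff_mul]
  rw [iteratedDeriv_mul (hf.of_le le_top) (hg.of_le le_top),
    Finset.Nat.sum_antidiagonal_eq_sum_range_succ
      (fun i j => iteratedDeriv i f 0 / (Nat.factorial i : ℝ) *
        (iteratedDeriv j g 0 / (Nat.factorial j : ℝ))), Finset.sum_div]
  refine Finset.sum_congr rfl fun i hi => ?_
  rw [Nat.cast_choose ℝ (Nat.lt_succ_iff.mp (Finset.mem_range.mp hi))]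
  have := Nat.factorial_ne_zero n
  field_simp

theorem taylorSeriesAtZero_exp : taylorSeriesAtZero Real.exp = PowerSeries.exp ℝ := by
  ext n
  simp [taylorSeriesAtZero, iteratedDeriv_eq_iterate, PowerSeries.coeff_exp]

theorem taylorSeriesAtZero_exp_sub_one :
    taylorSeriesAtZero (Real.exp - 1) = PowerSeries.exp ℝ - 1 := by
  ext n
  rcases n with _ | n
  · simp [taylorSeriesAtZero]
  · rw [map_sub, ← taylorSeriesAtZero_exp]
    have h : deriv (Real.exp - 1) = deriv Real.exp := by
      ext x
      exact deriv_sub_const (f := Real.exp) 1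
    simp [taylorSeriesAtZero, iteratedDeriv_succ', h, PowerSeries.coeff_one]

theorem taylorSeriesAtZero_pow (j : ℕ) :
    taylorSeriesAtZero (fun x => x ^ j) = (PowerSeries.X : PowerSeries ℝ) ^ j := by
  ext n
  rw [PowerSeries.coeff_X_pow]
  simp only [taylorSeriesAtZero, PowerSeries.coeff_mk, iteratedDeriv_fun_pow_zero]
  split_ifs with h
  · simp [h, Nat.factorial_ne_zero]
  · simp

theorem analyticAt_G_zero {j : ℕ} (hj : 1 ≤ j) : AnalyticAt ℝ (G j) 0 := by
  have hf : AnalyticAt ℝ (fun v : ℝ => 1 - Real.exp (-v)) 0 := by fun_prop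
  obtain ⟨p, hp⟩ := hf
  have hd : AnalyticAt ℝ (dslope (fun v : ℝ => 1 - Real.exp (-v)) 0) 0 :=
    ⟨_, hp.has_fpower_series_dslope_fslope⟩
  have h0 : dslope (fun v : ℝ => 1 - Real.exp (-v)) 0 0 = 1 := by
    rw [dslope_same]
    have : HasDerivAt (fun v : ℝ => 1 - Real.exp (-v)) (-(Real.exp (-0) * (-1))) 0 :=
      ((hasDerivAt_neg (0 : ℝ)).exp).const_sub 1
    simpa using this.deriv
  have hG : G j = fun v => v ^ (j - 1) * (dslope (fun v : ℝ => 1 - Real.exp (-v)) 0 v)⁻¹ := by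
    ext v
    rcases eq_or_ne v 0 with rfl | hv
    · rw [h0]
      rcases eq_or_ne j 1 with rfl | h
      · simp [G]
      · simp [G, h, show j - 1 ≠ 0 by omega]
    · rw [dslope_of_ne _ hv, slope_def_field]
      obtain ⟨m, rfl⟩ := Nat.exists_eq_add_of_le' hj
      simp [G, hv, pow_succ, div_eq_mul_inv, mul_assoc]
  rw [hG]
  exact (analyticAt_id.pow _).mul (hd.inv (h0.trans_ne one_ne_zero))

theorem G_mul_exp_sub_one {j : ℕ} (hj : 1 ≤ j) :
    G j * (Real.exp - 1) = (fun x => x ^ j) * Real.exp := by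
  ext v
  rcases eq_or_ne v 0 with rfl | hv
  · simp [show j ≠ 0 by omega]
  · have h : 1 - Real.exp (-v) ≠ 0 := by
      rw [sub_ne_zero, ne_comm, Ne, Real.exp_eq_one_iff, neg_eq_zero]
      exact hv
    have he : Real.exp v - 1 = (1 - Real.exp (-v)) * Real.exp v := by
      rw [sub_mul, ← Real.exp_add]
      simp
    simp only [Pi.mul_apply, Pi.sub_apply, Pi.one_apply, G, hv, if_false, he]
    field_simp

theorem taylorSeriesAtZero_G {j : ℕ} (hj : 1 ≤ j) :
    taylorSeriesAtZero (G j) = PowerSeries.X ^ (j - 1) * bernoulli'PowerSeries ℝ := by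
  have hne : PowerSeries.exp ℝ - 1 ≠ 0 := by
    intro h
    have := congrArg (PowerSeries.coeff 1) h
    simp [PowerSeries.coeff_exp, PowerSeries.coeff_one] at this
  apply mul_right_cancel₀ hne
  have hexp : ContDiffAt ℝ ⊤ Real.exp 0 := Real.contDiff_exp.contDiffAt
  have hpow : ContDiffAt ℝ ⊤ (fun x : ℝ => x ^ j) 0 := contDiffAt_id.pow j
  have hexp_sub : ContDiffAt ℝ ⊤ (Real.exp - 1) 0 := hexp.sub contDiffAt_const
  rw [mul_assoc, bernoulli'PowerSeries_mul_exp_sub_one, ← mul_assoc, ← pow_succ,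
    Nat.sub_add_cancel hj, ← taylorSeriesAtZero_exp_sub_one,
    ← taylorSeriesAtZero_mul (analyticAt_G_zero hj).contDiffAt hexp_sub,
    G_mul_exp_sub_one hj, taylorSeriesAtZero_mul hpow hexp,
    taylorSeriesAtZero_exp, taylorSeriesAtZero_pow]

/-- For `j ≥ 1` and `k ≥ j − 1`:
`G_j^{(k)}(0) = k! (-1)^{k-j+1} B_{k-j+1}/(k-j+1)!`, where `B_n` are the Bernoulli
numbers (`B₁ = -1/2`).  (Here `k - j + 1` is written as `k + 1 - j`, which is exact.) -/
theorem iteratedDeriv_G_zero_bernoulli (j k : ℕ) (hj : 1 ≤ j) (hk : j - 1 ≤ k) :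
    iteratedDeriv k (G j) 0 =
      (Nat.factorial k) * ((-1 : ℝ) ^ (k + 1 - j) * ((bernoulli (k + 1 - j) : ℚ) : ℝ) /
        (Nat.factorial (k + 1 - j))) := by
  have h := congrArg (PowerSeries.coeff k) (taylorSeriesAtZero_G hj)
  rw [PowerSeries.coeff_X_pow_mul', if_pos hk, bernoulli'PowerSeries, taylorSeriesAtZero,
    PowerSeries.coeff_mk, PowerSeries.coeff_mk, show k - (j - 1) = k + 1 - j by omega,
    div_eq_iff (by exact_mod_cast Nat.factorial_ne_zero k), mul_comm] at h
  rw [h, bernoulli]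
  push_cast
  rw [← mul_assoc ((-1 : ℝ) ^ _), ← mul_pow]
  simp
end

section
/- For every integer j ≥ 1 and every real v with |v| < 2π, f_j(v)/j! = 1/2 + Σ_{r=1}^{∞} C(j+2r−1, j) · (B_{2r}/(2r)!) · v^{2r−1}, where C(·,·) denotes the binomial coefficient, and this series converges for |v| < 2π. -/
/-- A real power series that converges absolutely for `|x| < R` can be differentiated termwise
without losing absolute convergence. -/
theorem summable_succ_mul_coeff_mul_pow {c : ℕ → ℝ} {R : ℝ}
    (hc : ∀ r, 0 ≤ r → r < R → Summable fun n => |c n| * r ^ n) {r : ℝ} (hr : 0 ≤ r)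
    (hrR : r < R) : Summable fun n : ℕ => |((n : ℝ) + 1) * c (n + 1)| * r ^ n := by
  obtain ⟨ρ, hrρ, hρR⟩ := exists_between hrR
  have hρ : 0 < ρ := hr.trans_lt hrρ
  have hs := hc ρ hρ.le hρR
  have hq : ‖r / ρ‖ < 1 := by
    rw [Real.norm_of_nonneg (by positivity)]
    exact (div_lt_one hρ).2 hrρ
  have hg := (summable_descFactorial_mul_geometric_of_norm_lt_one 1 hq).mul_left
    ((∑' n, |c n| * ρ ^ n) / ρ)
  refine Summable.of_nonneg_of_le (fun n => by positivity) (fun n => ?_) hg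
  have hle : |c (n + 1)| * ρ ^ (n + 1) ≤ ∑' n, |c n| * ρ ^ n :=
    hs.le_tsum (n + 1) fun _ _ => by positivity
  have hn : |(n : ℝ) + 1| = n + 1 := abs_of_nonneg (by positivity)
  have heq : |((n : ℝ) + 1) * c (n + 1)| * r ^ n =
      |c (n + 1)| * ρ ^ (n + 1) / ρ * ((n + 1) * (r / ρ) ^ n) := by
    rw [abs_mul, hn, div_pow, pow_succ]
    field_simp
  rw [heq, Nat.descFactorial_one]
  push_cast
  gcongr

theorem hasDerivAt_tsum_coeff_mul_pow {c : ℕ → ℝ} {R : ℝ}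
    (hc : ∀ r, 0 ≤ r → r < R → Summable fun n => |c n| * r ^ n) {x : ℝ} (hx : |x| < R) :
    HasDerivAt (fun y => ∑' n, c n * y ^ n) (∑' n : ℕ, ((n : ℝ) + 1) * c (n + 1) * x ^ n) x := by
  obtain ⟨ρ, hxρ, hρR⟩ := exists_between hx
  have hρ : 0 < ρ := (abs_nonneg x).trans_lt hxρ
  have hu : Summable fun n : ℕ => |(n : ℝ) * c n| * ρ ^ (n - 1) := by
    rw [← summable_nat_add_iff 1]
    simpa using summable_succ_mul_coeff_mul_pow hc hρ.le hρR
  have hbound : ∀ (n : ℕ) (y : ℝ), y ∈ Metric.ball (0 : ℝ) ρ →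
      ‖c n * (n * y ^ (n - 1))‖ ≤ |(n : ℝ) * c n| * ρ ^ (n - 1) := by
    intro n y hy
    have hy' : |y| ≤ ρ := by simpa using (mem_ball_zero_iff.1 hy).le
    rw [← mul_assoc, mul_comm (c n), norm_mul, norm_pow, Real.norm_eq_abs, Real.norm_eq_abs]
    gcongr
  have hxb : x ∈ Metric.ball (0 : ℝ) ρ := by simpa using hxρ
  have h := hasDerivAt_tsum_of_isPreconnected (g := fun n y => c n * y ^ n)
    (g' := fun n y => c n * (n * y ^ (n - 1))) hu Metric.isOpen_ball
    (convex_ball _ _).isPreconnected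
    (fun n y _ => (hasDerivAt_pow n y).const_mul (c n)) hbound (Metric.mem_ball_self hρ)
    (summable_of_ne_finset_zero (s := {0}) fun n hn => by
      simp [zero_pow (by simpa using hn : n ≠ 0)]) hxb
  convert! h using 1
  have hs : Summable fun n : ℕ => c n * (n * x ^ (n - 1)) :=
    Summable.of_norm_bounded hu fun n => hbound n x hxb
  rw [hs.tsum_eq_zero_add]
  simp only [Nat.cast_zero, zero_mul, mul_zero, zero_add, Nat.add_sub_cancel, Nat.cast_add,
    Nat.cast_one]
  exact tsum_congr fun n => by ring

/-- Term-by-term iterated differentiation of a real power series inside its disc of convergence. -/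
theorem hasSum_iteratedDeriv_of_eq_tsum (k : ℕ) {c : ℕ → ℝ} {R : ℝ} {F : ℝ → ℝ}
    (hc : ∀ r, 0 ≤ r → r < R → Summable fun n => |c n| * r ^ n)
    (hF : ∀ x, |x| < R → F x = ∑' n, c n * x ^ n) {x : ℝ} (hx : |x| < R) :
    HasSum (fun n : ℕ => ((n + k).descFactorial k : ℝ) * c (n + k) * x ^ n)
      (iteratedDeriv k F x) := by
  induction k generalizing c F with
  | zero =>
    have hs : Summable fun n => c n * x ^ n :=
      Summable.of_norm (by simpa using hc |x| (abs_nonneg x) hx)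
    simpa [hF x hx] using hs.hasSum
  | succ k ih =>
    have hderiv : ∀ y, |y| < R → deriv F y = ∑' n : ℕ, ((n : ℝ) + 1) * c (n + 1) * y ^ n := by
      intro y hy
      have hev : F =ᶠ[nhds y] fun z => ∑' n, c n * z ^ n := by
        filter_upwards [(isOpen_lt continuous_abs continuous_const).mem_nhds hy] with z hz
        exact hF z hz
      exact ((hasDerivAt_tsum_coeff_mul_pow hc hy).congr_of_eventuallyEq hev).deriv
    rw [iteratedDeriv_succ']
    convert! ih (c := fun n => ((n : ℝ) + 1) * c (n + 1))
      (fun r h0 h1 => summable_succ_mul_coeff_mul_pow hc h0 h1) hderiv using 2 with n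
    rw [← add_assoc, Nat.succ_descFactorial_succ]
    push_cast
    ring

theorem abs_bernoulli_div_factorial_mul_le {k : ℕ} (hk : k ≠ 0) :
    |(bernoulli (2 * k) : ℝ) / (2 * k).factorial| * (2 * Real.pi) ^ (2 * k) ≤
      2 * ∑' n : ℕ, 1 / (n : ℝ) ^ 2 := by
  have h := hasSum_zeta_nat hk
  have hle : ∑' n : ℕ, 1 / (n : ℝ) ^ (2 * k) ≤ ∑' n : ℕ, 1 / (n : ℝ) ^ 2 := by
    refine h.summable.tsum_le_tsum (fun n => ?_) (Real.summable_one_div_nat_pow.2 one_lt_two)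
    rcases Nat.eq_zero_or_pos n with rfl | hn
    · simp [hk]
    · have h1 : (1 : ℝ) ≤ n := by exact_mod_cast hn
      gcongr
      omega
  have hnonneg : 0 ≤ ∑' n : ℕ, 1 / (n : ℝ) ^ (2 * k) := tsum_nonneg fun n => by positivity
  have htwo : (2 : ℝ) ^ (2 * k) = 2 * 2 ^ (2 * k - 1) := by
    rw [← pow_succ', Nat.sub_add_cancel (by omega)]
  have habs : |(bernoulli (2 * k) : ℝ) / (2 * k).factorial| * (2 * Real.pi) ^ (2 * k) =
      2 * |∑' n : ℕ, 1 / (n : ℝ) ^ (2 * k)| := by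
    rw [h.tsum_eq, mul_div_assoc, abs_mul, abs_mul, abs_mul, abs_pow, abs_neg, abs_one, one_pow,
      abs_of_pos (by positivity : (0 : ℝ) < 2 ^ (2 * k - 1)),
      abs_of_pos (by positivity : (0 : ℝ) < Real.pi ^ (2 * k)), mul_pow, htwo]
    ring
  rw [habs, abs_of_nonneg hnonneg]
  gcongr

theorem summable_abs_bernoulli'_div_factorial_mul_pow {r : ℝ} (hr : 0 ≤ r)
    (hr' : r < 2 * Real.pi) :
    Summable fun n : ℕ => |(bernoulli' n : ℝ) / n.factorial| * r ^ n := by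
  rw [← summable_nat_add_iff 2]
  have hq : r / (2 * Real.pi) < 1 := (div_lt_one (by positivity)).2 hr'
  have hg := ((summable_geometric_of_lt_one (by positivity) hq).mul_left
    (2 * ∑' n : ℕ, 1 / (n : ℝ) ^ 2))
  refine Summable.of_nonneg_of_le (fun n => by positivity) (fun n => ?_)
    ((summable_nat_add_iff 2).2 hg)
  have hnonneg : 0 ≤ ∑' n : ℕ, 1 / (n : ℝ) ^ 2 := tsum_nonneg fun n => by positivity
  rcases Nat.even_or_odd (n + 2) with he | ho
  · obtain ⟨k, hk⟩ := he.two_dvd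
    have hk0 : k ≠ 0 := by omega
    rw [← bernoulli_eq_bernoulli'_of_ne_one (by omega : n + 2 ≠ 1), hk, div_pow, mul_div_assoc',
      le_div_iff₀ (by positivity), mul_right_comm]
    exact mul_le_mul_of_nonneg_right (abs_bernoulli_div_factorial_mul_le hk0) (by positivity)
  · rw [bernoulli'_eq_zero_of_odd ho (by omega)]
    simp only [Rat.cast_zero, zero_div, abs_zero, zero_mul]
    positivity

theorem tsum_bernoulli'_mul_exp_sub_one {x : ℝ} (hx : |x| < 2 * Real.pi) :
    (∑' n : ℕ, (bernoulli' n : ℝ) / n.factorial * x ^ n) * (Real.exp x - 1) =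
      x * Real.exp x := by
  have hexp : HasSum (fun n : ℕ => x ^ n / n.factorial) (Real.exp x) := by
    rw [Real.exp_eq_exp_ℝ]
    exact NormedSpace.expSeries_div_hasSum_exp x
  have hb : Summable fun n : ℕ => ‖(bernoulli' n : ℝ) / n.factorial * x ^ n‖ := by
    simpa only [norm_mul, norm_pow, Real.norm_eq_abs] using
      summable_abs_bernoulli'_div_factorial_mul_pow (abs_nonneg x) hx
  set e : PowerSeries ℝ := PowerSeries.exp ℝ - 1 with he
  have hes : HasSum (fun n : ℕ => PowerSeries.coeff n e * x ^ n) (Real.exp x - 1) := by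
    convert! hexp.sub (hasSum_ite_eq 0 (1 : ℝ)) using 2 with n
    by_cases hn : n = 0 <;> simp [he, PowerSeries.coeff_exp, PowerSeries.coeff_one, hn]; ring
  have hxe : HasSum (fun n : ℕ => PowerSeries.coeff n (PowerSeries.X * PowerSeries.exp ℝ) * x ^ n)
      (x * Real.exp x) := by
    rw [← hasSum_nat_add_iff' 1]
    simp only [Finset.sum_range_one, PowerSeries.coeff_zero_X_mul, zero_mul, sub_zero]
    convert! hexp.mul_left x using 2 with n
    rw [PowerSeries.coeff_succ_X_mul, PowerSeries.coeff_exp, eq_ratCast]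
    push_cast
    ring
  have hprod := tsum_mul_tsum_eq_tsum_sum_antidiagonal_of_summable_norm hb hes.summable.norm
  rw [hes.tsum_eq] at hprod
  rw [hprod, ← hxe.tsum_eq, ← bernoulli'PowerSeries_mul_exp_sub_one]
  refine tsum_congr fun n => ?_
  rw [PowerSeries.coeff_mul, Finset.sum_mul]
  refine Finset.sum_congr rfl fun p hp => ?_
  rw [← Finset.HasAntidiagonal.mem_antidiagonal.1 hp, pow_add]
  simp only [bernoulli'PowerSeries, PowerSeries.coeff_mk, eq_ratCast, Rat.cast_div,
    Rat.cast_natCast, he]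
  ring

theorem G_succ_eq_pow_mul_tsum (i : ℕ) {x : ℝ} (hx : |x| < 2 * Real.pi) :
    G (i + 1) x = x ^ i * ∑' n : ℕ, (bernoulli' n : ℝ) / n.factorial * x ^ n := by
  rcases eq_or_ne x 0 with rfl | h0
  · have h1 : ∑' n : ℕ, (bernoulli' n : ℝ) / n.factorial * 0 ^ n = 1 := by
      rw [tsum_eq_single 0 fun n hn => by simp [hn]]
      simp
    rw [h1]
    by_cases hi : i = 0 <;> simp [G, hi]
  · have h := tsum_bernoulli'_mul_exp_sub_one hx
    have hne : Real.exp x - 1 ≠ 0 := by simpa [sub_eq_zero] using h0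
    have hne' : 1 - Real.exp (-x) ≠ 0 := by simpa [sub_eq_zero, @eq_comm ℝ 1] using h0
    rw [← eq_div_iff hne] at h
    rw [G, if_neg h0, h, div_eq_iff hne', mul_div_assoc', div_mul_eq_mul_div, eq_div_iff hne, Real.exp_neg]
    field_simp
    ring

theorem hasSum_iteratedDeriv_G_div_factorial {j : ℕ} (hj : 1 ≤ j) {v : ℝ}
    (hv : |v| < 2 * Real.pi) :
    HasSum (fun n : ℕ => ((n + j).choose j : ℝ) *
      ((bernoulli' (n + 1) : ℝ) / (n + 1).factorial) * v ^ n)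
      (iteratedDeriv j (G j) v / j.factorial) := by
  obtain ⟨i, rfl⟩ := Nat.exists_eq_add_of_le' hj
  set c : ℕ → ℝ := fun m =>
    if m < i then 0 else (bernoulli' (m - i) : ℝ) / (m - i).factorial with hcdef
  have hci : ∀ n, c (n + i) = (bernoulli' n : ℝ) / n.factorial := fun n => by simp [hcdef]
  have hc : ∀ r, 0 ≤ r → r < 2 * Real.pi → Summable fun n => |c n| * r ^ n := by
    intro r h0 h1
    rw [← summable_nat_add_iff i]
    convert! (summable_abs_bernoulli'_div_factorial_mul_pow h0 h1).mul_left (r ^ i) using 2 with n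
    rw [hci, pow_add]
    ring
  have hG : ∀ x, |x| < 2 * Real.pi → G (i + 1) x = ∑' n, c n * x ^ n := by
    intro x hx
    have hs : Summable fun n => c n * x ^ n :=
      Summable.of_norm (by simpa using hc |x| (abs_nonneg x) hx)
    rw [G_succ_eq_pow_mul_tsum i hx, ← hs.sum_add_tsum_nat_add i, Finset.sum_eq_zero, zero_add,
      ← tsum_mul_left]
    · refine tsum_congr fun n => ?_
      rw [hci, pow_add]
      ring
    · intro m hm
      simp [hcdef, Finset.mem_range.1 hm]
  convert! (hasSum_iteratedDeriv_of_eq_tsum (i + 1) hc hG hv).div_const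
    ((i + 1).factorial : ℝ) using 2 with n
  rw [Nat.descFactorial_eq_factorial_mul_choose, show n + (i + 1) = n + 1 + i by ring, hci]
  push_cast
  field_simp

/-- For `j ≥ 1` and `|v| < 2π`, with `f_j = G_j^{(j)}`:
`f_j(v)/j! = 1/2 + Σ_{r=1}^∞ C(j+2r−1, j) (B_{2r}/(2r)!) v^{2r−1}`, the series converging
for `|v| < 2π`.  (The sum below is over `r : ℕ`, with `r + 1` playing the role of `r ≥ 1`.) -/
theorem f_powerSeries_bernoulli (j : ℕ) (hj : 1 ≤ j) (v : ℝ) (hv : |v| < 2 * Real.pi) :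
    HasSum
      (fun r : ℕ =>
        (Nat.choose (j + 2 * (r + 1) - 1) j : ℝ) *
          (((bernoulli (2 * (r + 1)) : ℚ) : ℝ) / (Nat.factorial (2 * (r + 1)))) *
          v ^ (2 * (r + 1) - 1))
      (iteratedDeriv j (G j) v / (Nat.factorial j) - 1 / 2) := by
  have h := (hasSum_nat_add_iff' 1).2 (hasSum_iteratedDeriv_G_div_factorial hj hv)
  rw [Finset.sum_range_one] at h
  have hinj : Function.Injective fun r : ℕ => 2 * r := fun a b hab => by
    simpa using hab
  rw [← hinj.hasSum_iff] at h
  · convert! h using 1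
    · funext r
      simp only [Function.comp_apply]
      rw [show 2 * r + 1 + 1 = 2 * (r + 1) by ring, bernoulli_eq_bernoulli'_of_ne_one (by omega),
        show j + 2 * (r + 1) - 1 = 2 * r + 1 + j by omega,
        show 2 * (r + 1) - 1 = 2 * r + 1 by omega]
    · simp
  · intro n hn
    have hodd : Odd (n + 1 + 1) := by
      rw [← Nat.not_even_iff_odd]
      rintro he
      obtain ⟨k, hk⟩ := he.two_dvd
      exact hn ⟨k - 1, by dsimp only; omega⟩
    simp [bernoulli'_eq_zero_of_odd hodd (by omega)]
end

section
/- For every integer j ≥ 1 and every integer k ≥ 1: f_j(0) = j!/2, the (2k−1)-th derivative of f_j at 0 equals (2k+j−1)! · B_{2k}/(2k)!, and the (2k)-th derivative of f_j at 0 equals 0. -/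
theorem G_one_eq_inv_dslope : G 1 = (dslope (fun v : ℝ => 1 - Real.exp (-v)) 0)⁻¹ := by
  have hd : HasDerivAt (fun v : ℝ => 1 - Real.exp (-v)) 1 0 := by
    simpa using ((Real.hasDerivAt_exp (-0)).comp (0 : ℝ) (hasDerivAt_neg 0)).const_sub 1
  funext v
  by_cases hv : v = 0
  · subst hv
    simp [G, hd.deriv]
  · simp [G, hv, dslope_of_ne, slope, div_eq_mul_inv, mul_comm]

theorem G_one_mul_exp_sub_one :
    (G 1 * fun v => Real.exp v - 1) = (fun v => v) * Real.exp := by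
  funext v
  by_cases hv : v = 0
  · simp [hv]
  · have h : 1 - Real.exp (-v) ≠ 0 := by
      rw [sub_ne_zero, ne_comm, Ne, Real.exp_eq_one_iff]
      simpa using hv
    simp only [G, hv, Pi.mul_apply, if_false, pow_one]
    rw [div_mul_eq_mul_div, div_eq_iff h, mul_assoc, mul_one_sub, ← Real.exp_add,
      add_neg_cancel, Real.exp_zero]

theorem sum_choose_mul_iteratedDeriv_G_one (n : ℕ) :
    ∑ i ∈ Finset.range n, (n.choose i : ℝ) * iteratedDeriv i (G 1) 0 = n := by
  have he (m : ℕ) : iteratedDeriv m Real.exp 0 = 1 := by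
    simp [iteratedDeriv_eq_iterate]
  have hs (m : ℕ) : iteratedDeriv m (fun v => Real.exp v - 1) 0 = if m = 0 then 0 else 1 := by
    rw [iteratedDeriv_fun_sub (by fun_prop) (by fun_prop), he, iteratedDeriv_const]
    split_ifs <;> simp
  have h := congrArg (fun f => iteratedDeriv n f 0) G_one_mul_exp_sub_one
  rw [iteratedDeriv_mul analyticAt_G_one.contDiffAt (by fun_prop),
    iteratedDeriv_mul (by fun_prop) (by fun_prop), Finset.sum_range_succ] at h
  simp only [hs, he, iteratedDeriv_fun_id_zero] at h
  have hr : ∑ i ∈ Finset.range (n + 1), (n.choose i : ℝ) * (if i = 1 then 1 else 0) * 1 = n := by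
    rcases n with _ | n <;> simp
  rw [hr] at h
  rw [← h]
  simp only [tsub_self, if_true, mul_zero, add_zero]
  refine Finset.sum_congr rfl fun i hi => ?_
  rw [if_neg (by have := Finset.mem_range.1 hi; omega), mul_one]

theorem iteratedDeriv_G_one_zero (n : ℕ) : iteratedDeriv n (G 1) 0 = (bernoulli' n : ℝ) := by
  induction n using Nat.strong_induction_on with
  | _ n ih =>
    have h1 := sum_choose_mul_iteratedDeriv_G_one (n + 1)
    have h2 : ∑ i ∈ Finset.range (n + 1), ((n + 1).choose i : ℝ) * (bernoulli' i : ℝ) =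
        (n + 1 : ℕ) := by
      exact_mod_cast sum_bernoulli' (n + 1)
    rw [Finset.sum_range_succ] at h1 h2
    rw [Finset.sum_congr rfl fun i hi => by rw [ih i (Finset.mem_range.1 hi)]] at h1
    have hn : ((n + 1).choose n : ℝ) ≠ 0 := by
      exact_mod_cast (Nat.choose_pos n.le_succ).ne'
    exact mul_left_cancel₀ hn (by linarith)

theorem G_succ_eq_pow_mul (j : ℕ) : G (j + 1) = (fun v => v ^ j) * G 1 := by
  funext v
  by_cases hv : v = 0
  · rcases j with _ | j <;> simp [G, hv]
  · simp [G, hv, pow_succ, mul_div_assoc]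

theorem iteratedDeriv_iteratedDeriv_G_zero (m j : ℕ) :
    iteratedDeriv m (iteratedDeriv (j + 1) (G (j + 1))) 0 =
      ((m + (j + 1)).factorial : ℝ) * (bernoulli' (m + 1) : ℝ) / (m + 1).factorial := by
  have hadd : iteratedDeriv m (iteratedDeriv (j + 1) (G (j + 1))) =
      iteratedDeriv (m + (j + 1)) (G (j + 1)) := by
    simp only [iteratedDeriv_eq_iterate, Function.iterate_add_apply]
  rw [hadd, G_succ_eq_pow_mul, iteratedDeriv_mul (by fun_prop) analyticAt_G_one.contDiffAt,
    Finset.sum_eq_single j]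
  · have hsub : m + (j + 1) - j = m + 1 := by omega
    have hfac := Nat.choose_mul_factorial_mul_factorial (show j ≤ m + (j + 1) by omega)
    rw [hsub] at hfac
    rw [iteratedDeriv_fun_pow_zero, if_pos rfl, hsub, iteratedDeriv_G_one_zero, ← hfac,
      eq_div_iff (by positivity)]
    push_cast
    ring
  · intro i _ hi
    rw [iteratedDeriv_fun_pow_zero, if_neg hi, Nat.cast_zero, mul_zero, zero_mul]
  · intro h
    exact absurd (Finset.mem_range.2 (by omega)) h

/-- For `j ≥ 1` and `k ≥ 1`, with `f_j = G_j^{(j)}`: `f_j(0) = j!/2`,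
`f_j^{(2k−1)}(0) = (2k+j−1)! B_{2k}/(2k)!`, and `f_j^{(2k)}(0) = 0`,
where `B_n` are the Bernoulli numbers. -/
theorem f_derivatives_at_zero (j k : ℕ) (hj : 1 ≤ j) (hk : 1 ≤ k) :
    iteratedDeriv j (G j) 0 = (Nat.factorial j : ℝ) / 2 ∧
    iteratedDeriv (2 * k - 1) (iteratedDeriv j (G j)) 0 =
      (Nat.factorial (2 * k + j - 1) : ℝ) * ((bernoulli (2 * k) : ℚ) : ℝ) /
        (Nat.factorial (2 * k)) ∧
    iteratedDeriv (2 * k) (iteratedDeriv j (G j)) 0 = 0 := by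
  obtain ⟨j, rfl⟩ := Nat.exists_eq_add_of_le' hj
  refine ⟨?_, ?_, ?_⟩
  · have h := iteratedDeriv_iteratedDeriv_G_zero 0 j
    rw [iteratedDeriv_zero] at h
    simp [h, div_eq_mul_inv]
  · rw [iteratedDeriv_iteratedDeriv_G_zero, show 2 * k - 1 + 1 = 2 * k by omega,
      show 2 * k - 1 + (j + 1) = 2 * k + (j + 1) - 1 by omega,
      bernoulli_eq_bernoulli'_of_ne_one (by omega)]
  · rw [iteratedDeriv_iteratedDeriv_G_zero,
      bernoulli'_eq_zero_of_odd (odd_two_mul_add_one k) (by omega)]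
    simp
end

section
/- For every fixed integer j ≥ 6, the extended sequence a_0 = |f_j(0)| = j!/2 and a_k = |f_j^{(2k−1)}(0)| = (2k+j−1)! · |B_{2k}|/(2k)! for k ≥ 1 is logarithmically convex; in particular a_1² ≤ a_0 · a_2, that is, ((j+1)!/12)² ≤ (j!/2) · ((j+3)!/720). -/
/-- `v / (1 - e^{-v})`, extended analytically to `v = 0`. -/
noncomputable def bernoulliGen (v : ℝ) : ℝ :=
  (dslope (fun u : ℝ => 1 - Real.exp (-u)) 0 v)⁻¹

theorem bernoulliGen_of_ne_zero {v : ℝ} (hv : v ≠ 0) :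
    bernoulliGen v = v / (1 - Real.exp (-v)) := by
  simp [bernoulliGen, dslope_of_ne _ hv, slope_def_field]

theorem analyticAt_bernoulliGen : AnalyticAt ℝ bernoulliGen 0 := by
  have hE : AnalyticAt ℝ (fun u : ℝ => 1 - Real.exp (-u)) 0 := by fun_prop
  obtain ⟨p, hp⟩ := hE
  refine AnalyticAt.inv ⟨_, hp.has_fpower_series_dslope_fslope⟩ ?_
  have h : HasDerivAt (fun u : ℝ => 1 - Real.exp (-u)) 1 0 := by
    simpa using ((hasDerivAt_neg (0 : ℝ)).exp).const_sub 1
  simp [dslope_same, h.deriv]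

theorem bernoulliGen_mul_exp_sub_one (v : ℝ) :
    bernoulliGen v * (Real.exp v - 1) = v * Real.exp v := by
  rcases eq_or_ne v 0 with rfl | hv
  · simp
  have h : 1 - Real.exp (-v) ≠ 0 := by
    rw [sub_ne_zero, ne_comm]
    simpa using hv
  have he : Real.exp v - 1 = Real.exp v * (1 - Real.exp (-v)) := by
    rw [mul_sub, ← Real.exp_add]; simp
  rw [bernoulliGen_of_ne_zero hv, he]
  field_simp

theorem iteratedDeriv_bernoulliGen_zero (n : ℕ) :
    iteratedDeriv n bernoulliGen 0 = ((bernoulli' n : ℚ) : ℝ) := by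
  have sum_eq (m : ℕ) :
      ∑ i ∈ Finset.range m, (m.choose i : ℝ) * iteratedDeriv i bernoulliGen 0 = m := by
    have hfun : (fun v => bernoulliGen v * (Real.exp v - 1)) = fun v => v * Real.exp v :=
      funext bernoulliGen_mul_exp_sub_one
    have h := congrArg (fun f => iteratedDeriv m f 0) hfun
    have hexp (k : ℕ) : iteratedDeriv k Real.exp 0 = 1 := by
      simp [iteratedDeriv_eq_iterate, Real.iter_deriv_exp]
    have hsub (k : ℕ) :
        iteratedDeriv k (fun v => Real.exp v - 1) 0 = if k = 0 then 0 else 1 := by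
      rcases k with _ | k
      · simp
      · rw [iteratedDeriv_succ']
        have : deriv (fun v => Real.exp v - 1) = Real.exp := by ext; simp
        simp [this, hexp]
    have hid (k : ℕ) : iteratedDeriv k (fun v : ℝ => v) 0 = if k = 1 then 1 else 0 := by
      simpa using iteratedDeriv_fun_pow_zero (𝕜 := ℝ) (n := k) (m := 1)
    beta_reduce at h
    rw [iteratedDeriv_fun_mul analyticAt_bernoulliGen.contDiffAt
        (Real.contDiff_exp.sub contDiff_const).contDiffAt,
      iteratedDeriv_fun_mul contDiff_fun_id.contDiffAt Real.contDiff_exp.contDiffAt,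
      Finset.sum_range_succ] at h
    simp only [hsub, hexp, hid, Nat.sub_self, if_true, mul_zero, add_zero, mul_one, mul_ite] at h
    rw [Finset.sum_ite_eq'] at h
    trans if 1 ∈ Finset.range (m + 1) then (m.choose 1 : ℝ) else 0
    · rw [← h]
      refine Finset.sum_congr rfl fun i hi => ?_
      rw [if_neg (Nat.sub_ne_zero_of_lt (Finset.mem_range.mp hi))]
    · rcases m with _ | m <;> simp
  induction n using Nat.strong_induction_on with
  | _ n ih =>
    have h1 := sum_eq (n + 1)
    have h2 := congrArg (fun q : ℚ => (q : ℝ)) (sum_bernoulli' (n + 1))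
    push_cast at h2
    rw [Finset.sum_range_succ] at h1 h2
    rw [Finset.sum_congr rfl fun i hi => by rw [ih i (Finset.mem_range.mp hi)]] at h1
    have hc : ((n + 1).choose n : ℝ) ≠ 0 := by simp; positivity
    refine mul_left_cancel₀ hc ?_
    push_cast at h1
    linarith

theorem G_succ_eq_pow_mul_bernoulliGen {m : ℕ} (hm : m ≠ 0) :
    G (m + 1) = fun v => v ^ m * bernoulliGen v := by
  ext v
  rcases eq_or_ne v 0 with rfl | hv
  · simp [G, hm]
  · simp only [G, if_neg hv, bernoulliGen_of_ne_zero hv]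
    ring

theorem iteratedDeriv_G_succ_zero {m : ℕ} (hm : m ≠ 0) (n : ℕ) :
    iteratedDeriv (m + n) (G (m + 1)) 0 =
      (Nat.factorial (m + n) : ℝ) * ((bernoulli' n : ℚ) : ℝ) / Nat.factorial n := by
  rw [G_succ_eq_pow_mul_bernoulliGen hm,
    iteratedDeriv_fun_mul (contDiff_fun_id.pow m).contDiffAt analyticAt_bernoulliGen.contDiffAt]
  simp only [iteratedDeriv_fun_pow_zero, iteratedDeriv_bernoulliGen_zero, Nat.cast_ite,
    Nat.cast_zero, mul_ite, ite_mul,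
    mul_zero, zero_mul]
  rw [Finset.sum_ite_eq', if_pos (by simp), Nat.add_sub_cancel_left,
    eq_div_iff (by positivity), ← Nat.add_choose_mul_factorial_mul_factorial m n,
    Nat.choose_symm_add]
  push_cast
  ring

theorem zeta_nat_log_convex {k : ℕ} {x y z : ℝ} (hk : k ≠ 0)
    (hx : HasSum (fun n : ℕ => 1 / (n : ℝ) ^ (2 * k)) x)
    (hy : HasSum (fun n : ℕ => 1 / (n : ℝ) ^ (2 * (k + 1))) y)
    (hz : HasSum (fun n : ℕ => 1 / (n : ℝ) ^ (2 * (k + 2))) z) :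
    y ^ 2 ≤ x * z := by
  have h (t : ℝ) : 0 ≤ z * (t * t) + (-2 * y) * t + x := by
    have hs := ((hz.mul_right (t * t)).add ((hy.mul_left (-2)).mul_right t)).add hx
    refine hs.nonneg fun n => ?_
    rcases eq_or_ne n 0 with rfl | hn
    · simp [hk]
    · have hn' : (n : ℝ) ≠ 0 := by exact_mod_cast hn
      have : 1 / (n : ℝ) ^ (2 * (k + 2)) * (t * t) + -2 * (1 / (n : ℝ) ^ (2 * (k + 1))) * t
          + 1 / (n : ℝ) ^ (2 * k) = (t - n ^ 2) ^ 2 / ((n : ℝ) ^ (k + 2)) ^ 2 := by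
        field_simp
        ring
      rw [this]
      positivity
  have := discrim_le_zero h
  rw [discrim] at this
  linarith

theorem hasSum_zeta_nat_abs_bernoulli {k : ℕ} (hk : k ≠ 0) :
    HasSum (fun n : ℕ => 1 / (n : ℝ) ^ (2 * k))
      ((2 * Real.pi) ^ (2 * k) / 2 *
        (|((bernoulli (2 * k) : ℚ) : ℝ)| / Nat.factorial (2 * k))) := by
  have h := hasSum_zeta_nat hk
  have h0 := h.nonneg fun n => by positivity
  convert h using 1
  rw [← abs_of_nonneg h0]
  simp only [abs_mul, abs_div, abs_pow, abs_neg, abs_one, one_pow, one_mul, Nat.abs_cast,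
    Nat.abs_ofNat, abs_of_pos Real.pi_pos]
  rw [mul_pow, ← pow_sub_one_mul (by omega : 2 * k ≠ 0) (2 : ℝ)]
  ring

theorem abs_bernoulli_div_factorial_log_convex {k : ℕ} (hk : k ≠ 0) :
    (|((bernoulli (2 * (k + 1)) : ℚ) : ℝ)| / Nat.factorial (2 * (k + 1))) ^ 2 ≤
      |((bernoulli (2 * k) : ℚ) : ℝ)| / Nat.factorial (2 * k) *
        (|((bernoulli (2 * (k + 2)) : ℚ) : ℝ)| / Nat.factorial (2 * (k + 2))) := by
  have h := zeta_nat_log_convex hk (hasSum_zeta_nat_abs_bernoulli hk)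
    (hasSum_zeta_nat_abs_bernoulli k.succ_ne_zero)
    (hasSum_zeta_nat_abs_bernoulli (k + 1).succ_ne_zero)
  have hc : 0 < ((2 * Real.pi) ^ (2 * (k + 1)) / 2) ^ 2 := by positivity
  refine le_of_mul_le_mul_left ?_ hc
  refine (Eq.le ?_).trans (h.trans (Eq.le ?_)) <;> ring

theorem factorial_log_convex (n : ℕ) :
    (Nat.factorial (n + 2) : ℝ) ^ 2 ≤ Nat.factorial n * Nat.factorial (n + 4) := by
  simp only [Nat.factorial_succ]
  push_cast
  have hn : (0 : ℝ) ≤ n := n.cast_nonneg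
  have hf : (0 : ℝ) ≤ (Nat.factorial n : ℝ) ^ 2 * ((n + 1) * (n + 2)) := by positivity
  nlinarith [mul_nonneg hf (by linarith : (0 : ℝ) ≤ 4 * n + 10)]

theorem factorial_succ_div_sq_le {j : ℕ} (hj : 6 ≤ j) :
    ((Nat.factorial (j + 1) : ℝ) / 12) ^ 2 ≤
      ((Nat.factorial j : ℝ) / 2) * ((Nat.factorial (j + 3) : ℝ) / 720) := by
  simp only [Nat.factorial_succ]
  push_cast
  have hj' : (6 : ℝ) ≤ j := by exact_mod_cast hj
  have hf : (0 : ℝ) ≤ (Nat.factorial j : ℝ) ^ 2 * (j + 1) := by positivity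
  have hq : (0 : ℝ) ≤ (j + 2) * (j + 3) - 10 * (j + 1) := by nlinarith
  nlinarith [mul_nonneg hf hq]

theorem bernoulli_four : bernoulli 4 = -1 / 30 := by
  rw [bernoulli_eq_bernoulli'_of_ne_one (by norm_num), bernoulli'_four]

/-- For fixed `j ≥ 6`, the extended sequence `a_0 = |f_j(0)| = j!/2`,
`a_k = |f_j^{(2k−1)}(0)| = (2k+j−1)! |B_{2k}|/(2k)!` for `k ≥ 1` (`f_j = G_j^{(j)}`)
is logarithmically convex; in particular `((j+1)!/12)² ≤ (j!/2)((j+3)!/720)`. -/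
theorem abs_f_deriv_log_convex_extended (j : ℕ) (hj : 6 ≤ j) :
    let a : ℕ → ℝ := fun k =>
      if k = 0 then |iteratedDeriv j (G j) 0|
      else |iteratedDeriv (2 * k - 1) (iteratedDeriv j (G j)) 0|
    (a 0 = (Nat.factorial j : ℝ) / 2) ∧
    (∀ k : ℕ, 1 ≤ k →
      a k = (Nat.factorial (2 * k + j - 1) : ℝ) * |((bernoulli (2 * k) : ℚ) : ℝ)| /
        (Nat.factorial (2 * k))) ∧
    (∀ k : ℕ, 1 ≤ k → a k ^ 2 ≤ a (k - 1) * a (k + 1)) ∧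
    ((Nat.factorial (j + 1) : ℝ) / 12) ^ 2 ≤
      ((Nat.factorial j : ℝ) / 2) * ((Nat.factorial (j + 3) : ℝ) / 720) := by
  intro a
  obtain ⟨m, rfl⟩ : ∃ m, j = m + 1 := ⟨j - 1, by omega⟩
  have hm : m ≠ 0 := by omega
  have h0 : a 0 = (Nat.factorial (m + 1) : ℝ) / 2 := by
    simp only [a, if_true, iteratedDeriv_G_succ_zero hm 1, bernoulli'_one]
    push_cast
    rw [abs_of_nonneg (by positivity)]
    simp
    ring
  have hpos (k : ℕ) (hk : 1 ≤ k) :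
      a k = (Nat.factorial (2 * k + (m + 1) - 1) : ℝ) * |((bernoulli (2 * k) : ℚ) : ℝ)| /
        (Nat.factorial (2 * k)) := by
    simp only [a, if_neg (by omega : k ≠ 0)]
    rw [iteratedDeriv_eq_iterate (n := 2 * k - 1), iteratedDeriv_eq_iterate,
      ← Function.iterate_add_apply, ← iteratedDeriv_eq_iterate,
      show 2 * k - 1 + (m + 1) = m + 2 * k by omega,
      show 2 * k + (m + 1) - 1 = m + 2 * k by omega, iteratedDeriv_G_succ_zero hm,
      bernoulli_eq_bernoulli'_of_ne_one (by omega), abs_div, abs_mul, Nat.abs_cast, Nat.abs_cast]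
  refine ⟨h0, hpos, fun k hk => ?_, factorial_succ_div_sq_le hj⟩
  obtain ⟨k, rfl⟩ : ∃ l, k = l + 1 := ⟨k - 1, by omega⟩
  rw [Nat.add_sub_cancel, hpos (k + 1) hk, hpos (k + 1 + 1) (by omega)]
  rcases eq_or_ne k 0 with rfl | hk0
  · rw [h0]
    convert factorial_succ_div_sq_le hj using 2
    · rw [show 2 * (0 + 1) + (m + 1) - 1 = m + 1 + 1 by omega]
      norm_num [bernoulli_two, Nat.factorial]
      ring
    · rw [show 2 * (0 + 1 + 1) + (m + 1) - 1 = m + 1 + 3 by omega]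
      norm_num [bernoulli_four, Nat.factorial]
      ring
  · rw [hpos k (by omega)]
    have h := mul_le_mul (factorial_log_convex (2 * k + m))
      (abs_bernoulli_div_factorial_log_convex hk0) (by positivity) (by positivity)
    rw [show 2 * (k + 1) + (m + 1) - 1 = 2 * k + m + 2 by omega,
      show 2 * k + (m + 1) - 1 = 2 * k + m by omega,
      show 2 * (k + 1 + 1) + (m + 1) - 1 = 2 * k + m + 4 by omega]
    refine (Eq.le ?_).trans (h.trans (Eq.le ?_)) <;> ring
end

section
/- For every integer j ≥ 0 and every real v ≠ 0, the j-th derivative of the function v ↦ 1/(1 − e^{-v}) at v equals Σ_{ℓ=0}^{j} (-1)^ℓ · ℓ! · S(j+1, ℓ+1) · (1/(1 − e^{-v}))^{ℓ+1}. -/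
theorem S_succ_succ (n k : ℕ) : S (n + 1) (k + 1) = (k + 1) * S n (k + 1) + S n k := by
  rw [S]

theorem S_succ_zero (n : ℕ) : S (n + 1) 0 = 0 := by
  rw [S]

theorem S_eq_zero_of_lt {n k : ℕ} (h : n < k) : S n k = 0 := by
  induction n generalizing k with
  | zero =>
    obtain ⟨k, rfl⟩ := Nat.exists_eq_succ_of_ne_zero h.ne'
    rw [S]
  | succ n ih =>
    obtain ⟨k, rfl⟩ := Nat.exists_eq_succ_of_ne_zero (Nat.ne_zero_of_lt h)
    rw [S_succ_succ, ih (by omega), ih (by omega), mul_zero]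

/-- Applying the derivation `x ↦ x - x ^ 2` to the `j`-th Stirling polynomial yields the next. -/
theorem sum_S_mul_pow_succ (j : ℕ) (x : ℝ) :
    ∑ ℓ ∈ Finset.range (j + 1), (-1 : ℝ) ^ ℓ * (Nat.factorial ℓ) * (S (j + 1) (ℓ + 1)) *
        ((ℓ + 1) * x ^ ℓ * (x - x ^ 2)) =
      ∑ ℓ ∈ Finset.range (j + 2), (-1 : ℝ) ^ ℓ * (Nat.factorial ℓ) * (S (j + 2) (ℓ + 1)) *
        x ^ (ℓ + 1) := by
  have split : ∀ ℓ : ℕ, (-1 : ℝ) ^ ℓ * (Nat.factorial ℓ) * (S (j + 2) (ℓ + 1)) * x ^ (ℓ + 1) =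
      (-1 : ℝ) ^ ℓ * (Nat.factorial ℓ) * (ℓ + 1) * (S (j + 1) (ℓ + 1)) * x ^ (ℓ + 1) +
        (-1 : ℝ) ^ ℓ * (Nat.factorial ℓ) * (S (j + 1) ℓ) * x ^ (ℓ + 1) := by
    intro ℓ
    rw [S_succ_succ (j + 1) ℓ]
    push_cast
    ring
  simp_rw [split]
  rw [Finset.sum_add_distrib, Finset.sum_range_succ _ (j + 1),
    S_eq_zero_of_lt (Nat.lt_succ_self (j + 1)), Finset.sum_range_succ' _ (j + 1), S_succ_zero]
  simp only [Nat.cast_zero, mul_zero, zero_mul, add_zero]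
  rw [← Finset.sum_add_distrib]
  refine Finset.sum_congr rfl fun ℓ _ => ?_
  rw [Nat.factorial_succ]
  push_cast
  ring

theorem hasDerivAt_one_div_one_sub_exp_neg {v : ℝ} (hv : v ≠ 0) :
    HasDerivAt (fun v : ℝ => 1 / (1 - Real.exp (-v)))
      (1 / (1 - Real.exp (-v)) - (1 / (1 - Real.exp (-v))) ^ 2) v := by
  have hne : 1 - Real.exp (-v) ≠ 0 := by
    rw [sub_ne_zero, ne_comm, Ne, Real.exp_eq_one_iff, neg_eq_zero]
    exact hv
  have h := ((hasDerivAt_neg v).exp.const_sub 1).fun_inv hne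
  simp only [one_div]
  refine h.congr_deriv ?_
  field_simp
  ring

/-- For `j ≥ 0` and `v ≠ 0`, the `j`-th derivative of `v ↦ 1/(1 − e^{-v})` equals
`Σ_{ℓ=0}^{j} (-1)^ℓ ℓ! S(j+1, ℓ+1) (1/(1 − e^{-v}))^{ℓ+1}`. -/
theorem iteratedDeriv_one_div_one_sub_exp_neg (j : ℕ) (v : ℝ) (hv : v ≠ 0) :
    iteratedDeriv j (fun v : ℝ => 1 / (1 - Real.exp (-v))) v =
      ∑ ℓ ∈ Finset.range (j + 1),
        (-1 : ℝ) ^ ℓ * (Nat.factorial ℓ) * (S (j + 1) (ℓ + 1)) *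
          (1 / (1 - Real.exp (-v))) ^ (ℓ + 1) := by
  induction j generalizing v with
  | zero => simp [S]
  | succ j ih =>
    rw [iteratedDeriv_succ, Filter.EventuallyEq.deriv_eq
      ((eventually_ne_nhds hv).mono fun w hw => ih w hw), ← sum_S_mul_pow_succ]
    refine (HasDerivAt.fun_sum fun ℓ _ => ?_).deriv
    simpa using ((hasDerivAt_one_div_one_sub_exp_neg hv).fun_pow (ℓ + 1)).const_mul
      ((-1 : ℝ) ^ ℓ * (Nat.factorial ℓ) * (S (j + 1) (ℓ + 1)))
end
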